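/- arXiv:2301.05656 — 2 statements merged into one kernel-verified Lean document; each statement's English description precedes it below -/
import Mathlib

section
/- Fix θ with 0 < θ ≤ π/4 and let f_θ(x) denote the number of pairs (a, b) of coprime positive integers of opposite parity satisfying a² + b² < x² and b ≤ a·tan(θ). Then f_θ(x) ∼ 2θ·x²/π² as x → ∞, i.e. f_θ(x)/(2θ·x²/π²) → 1. -/
open Filter Real MeasureTheory Set ArithmeticFunction

theorem moebius_two_mul (n : ℕ) : moebius (2 * n) = if Odd n then -moebius n else 0 := by
  split_ifs with h
  · rw [isMultiplicative_moebius.map_mul_of_coprime (Nat.coprime_two_left.mpr h),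
      moebius_apply_prime Nat.prime_two, neg_one_mul]
  · obtain ⟨m, rfl⟩ := (Nat.not_odd_iff_even.mp h).two_dvd
    refine moebius_eq_zero_of_not_squarefree fun hs => ?_
    have := hs 2 ⟨m, by ring⟩
    simp at this

theorem hasSum_moebius_div_sq : HasSum (fun n : ℕ => (moebius n : ℝ) / n ^ 2) (6 / π ^ 2) := by
  have h2 : (1 : ℝ) < (2 : ℂ).re := by norm_num
  have h := (LSeriesSummable_moebius_iff.mpr h2).LSeriesHasSum
  have hval := LSeries_zeta_mul_Lseries_moebius h2
  rw [LSeries_zeta_eq_riemannZeta h2, riemannZeta_two] at hval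
  have hπ : (π : ℂ) ≠ 0 := by exact_mod_cast pi_ne_zero
  have hval' : LSeries (fun n => (moebius n : ℂ)) 2 = ((6 / π ^ 2 : ℝ) : ℂ) := by
    push_cast
    field_simp at hval ⊢
    linear_combination hval
  rw [LSeriesHasSum, hval'] at h
  rw [← Complex.hasSum_ofReal]
  convert! h using 2 with n
  rw [LSeries.term_def₀ (by simp)]
  push_cast
  rw [Complex.cpow_neg, div_eq_mul_inv]
  norm_cast

theorem hasSum_odd_moebius_div_sq :
    HasSum (fun n : ℕ => if Odd n then (moebius n : ℝ) / n ^ 2 else 0) (8 / π ^ 2) := by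
  set u : ℕ → ℝ := fun n => (moebius n : ℝ) / n ^ 2
  set v : ℕ → ℝ := fun n => if Odd n then u n else 0
  have hu : HasSum u (6 / π ^ 2) := hasSum_moebius_div_sq
  have hv : Summable v := by
    refine (hu.summable.indicator {n | Odd n}).congr fun n => ?_
    simp [Set.indicator_apply, v]
  have hvs := hv.hasSum
  have hdiff : HasSum (fun n => u n - v n) (6 / π ^ 2 - ∑' n, v n) := hu.sub hvs
  have heven : HasSum (fun n => u n - v n) (-(1 / 4) * ∑' n, v n) := by
    have hinj : Function.Injective (fun n : ℕ => 2 * n) := fun a b h => by simpa using h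
    rw [← hinj.hasSum_iff]
    · refine (hvs.mul_left (-(1 / 4))).congr_fun ?_
      intro n
      have h2 : ¬ Odd (2 * n) := by simp
      simp only [Function.comp, u, v, moebius_two_mul, if_neg h2]
      split_ifs with h
      · push_cast; ring
      · simp
    · intro n hn
      have : Odd n := by
        by_contra h
        obtain ⟨m, rfl⟩ := (Nat.not_odd_iff_even.mp h).two_dvd
        exact hn ⟨m, rfl⟩
      simp [v, this]
  have := hdiff.unique heven
  have e : ∑' n, v n = 8 / π ^ 2 := by
    linear_combination -(4 / 3) * this
  exact e ▸ hvs

/-- The part of the open unit disc in the first quadrant that lies below the ray of angle `θ`. -/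
def unitSector (θ : ℝ) : Set (ℝ × ℝ) :=
  {p | 0 < p.1 ∧ 0 < p.2 ∧ p.1 ^ 2 + p.2 ^ 2 < 1 ∧ p.2 ≤ p.1 * tan θ}

theorem measurableSet_unitSector (θ : ℝ) : MeasurableSet (unitSector θ) := by
  unfold unitSector
  measurability

theorem convex_unitSector (θ : ℝ) : Convex ℝ (unitSector θ) := by
  rintro ⟨a, b⟩ ⟨h1, h2, h3, h4⟩ ⟨c, d⟩ ⟨k1, k2, k3, k4⟩ s t hs ht hst
  simp only [unitSector, mem_ofPred_eq, Prod.smul_mk, Prod.mk_add_mk, smul_eq_mul] at *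
  have hpos : 0 < s ∨ 0 < t := by
    by_contra! h
    linarith
  have key : ∀ y z : ℝ, 0 < y → 0 < z → 0 < s * y + t * z := by
    intro y z hy hz
    rcases hpos with h | h <;> positivity
  refine ⟨key _ _ h1 k1, key _ _ h2 k2, ?_, by nlinarith⟩
  have e := key _ _ (sub_pos.mpr h3) (sub_pos.mpr k3)
  have : t = 1 - s := by linarith
  subst this
  nlinarith [mul_nonneg (mul_nonneg hs ht) (add_nonneg (sq_nonneg (a - c)) (sq_nonneg (b - d)))]

theorem unitSector_subset (θ : ℝ) : unitSector θ ⊆ Icc 0 1 := by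
  rintro ⟨a, b⟩ ⟨h1, h2, h3, -⟩
  simp only at h1 h2 h3
  refine ⟨⟨h1.le, h2.le⟩, ⟨?_, ?_⟩⟩ <;> simp only [Prod.fst_one, Prod.snd_one] <;> nlinarith

theorem smul_mem_unitSector {θ t : ℝ} (ht : 0 < t) (ht' : t ≤ 1) {p : ℝ × ℝ}
    (hp : p ∈ unitSector θ) : t • p ∈ unitSector θ := by
  obtain ⟨h1, h2, h3, h4⟩ := hp
  refine ⟨mul_pos ht h1, mul_pos ht h2, ?_, ?_⟩
  · simp only [Prod.smul_fst, Prod.smul_snd, smul_eq_mul]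
    have : t ^ 2 ≤ 1 := pow_le_one₀ ht.le ht'
    nlinarith [sq_nonneg p.1, sq_nonneg p.2]
  · simp only [Prod.smul_fst, Prod.smul_snd, smul_eq_mul]
    nlinarith

theorem polarCoord_symm_mem_unitSector_iff {θ : ℝ} (hθ : 0 < θ) (hθ' : θ < π / 2) {q : ℝ × ℝ}
    (hq : q ∈ polarCoord.target) :
    polarCoord.symm q ∈ unitSector θ ↔ q ∈ Ioo (0 : ℝ) 1 ×ˢ Ioc 0 θ := by
  obtain ⟨r, φ⟩ := q
  obtain ⟨hr, h1, h2⟩ := hq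
  simp only [mem_Ioi] at hr h1 h2
  have hc : 0 < cos θ := cos_pos_of_mem_Ioo ⟨by linarith, hθ'⟩
  have hsq : (r * cos φ) ^ 2 + (r * sin φ) ^ 2 = r ^ 2 := by
    linear_combination r ^ 2 * sin_sq_add_cos_sq φ
  have hlt : r ^ 2 < 1 ↔ r < 1 := by
    rw [sq_lt_one_iff₀ hr.le]
  have htan : r * sin φ ≤ r * cos φ * tan θ ↔ sin (φ - θ) ≤ 0 := by
    rw [tan_eq_sin_div_cos, ← mul_div_assoc, le_div_iff₀ hc, mul_assoc, mul_assoc,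
      mul_le_mul_iff_right₀ hr, sin_sub, sub_nonpos]
  simp only [unitSector, polarCoord_symm_apply, mem_ofPred_eq, hsq, hlt, htan, mem_prod, mem_Ioo,
    mem_Ioc, mul_pos_iff_of_pos_left hr]
  constructor
  · rintro ⟨-, hs, hr1, hle⟩
    have hφ : 0 < φ := by
      by_contra! h
      exact hs.not_ge (sin_nonpos_of_nonpos_of_neg_pi_le h h1.le)
    refine ⟨⟨hr, hr1⟩, hφ, ?_⟩
    by_contra! h
    exact hle.not_gt (sin_pos_of_pos_of_lt_pi (by linarith) (by linarith))
  · rintro ⟨⟨-, hr1⟩, hφ, hle⟩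
    exact ⟨cos_pos_of_mem_Ioo ⟨by linarith, by linarith⟩, sin_pos_of_pos_of_lt_pi hφ h2, hr1,
      sin_nonpos_of_nonpos_of_neg_pi_le (by linarith) (by linarith)⟩

theorem volume_real_unitSector {θ : ℝ} (hθ : 0 < θ) (hθ' : θ < π / 2) :
    volume.real (unitSector θ) = θ / 2 := by
  have hsub : Ioo (0 : ℝ) 1 ×ˢ Ioc 0 θ ⊆ polarCoord.target :=
    prod_mono Ioo_subset_Ioi_self fun φ hφ => ⟨by linarith [hφ.1, pi_pos], by linarith [hφ.2]⟩
  have hmeas : MeasurableSet (Ioo (0 : ℝ) 1 ×ˢ Ioc 0 θ) := measurableSet_Ioo.prod measurableSet_Ioc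
  calc volume.real (unitSector θ)
      = ∫ p, (unitSector θ).indicator (1 : ℝ × ℝ → ℝ) p := by
        rw [integral_indicator_one (measurableSet_unitSector θ)]
    _ = ∫ q in polarCoord.target,
          q.1 • (unitSector θ).indicator (1 : ℝ × ℝ → ℝ) (polarCoord.symm q) :=
        (integral_comp_polarCoord_symm _).symm
    _ = ∫ q in polarCoord.target, (Ioo (0 : ℝ) 1 ×ˢ Ioc 0 θ).indicator (fun q => q.1) q := by
        refine setIntegral_congr_fun polarCoord.open_target.measurableSet fun q hq => ?_
        have h := polarCoord_symm_mem_unitSector_iff hθ hθ' hq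
        by_cases hq' : q ∈ Ioo (0 : ℝ) 1 ×ˢ Ioc 0 θ
        · rw [indicator_of_mem hq', indicator_of_mem (h.mpr hq')]
          simp
        · rw [indicator_of_notMem hq', indicator_of_notMem (mt h.mp hq'), smul_zero]
    _ = ∫ q in Ioo (0 : ℝ) 1 ×ˢ Ioc 0 θ, q.1 * 1 := by
        rw [setIntegral_indicator hmeas, inter_eq_right.mpr hsub]
        simp
    _ = θ / 2 := by
        rw [Measure.volume_eq_prod, setIntegral_prod_mul (fun r : ℝ => r) (fun _ : ℝ => (1 : ℝ)),
          ← integral_Ioc_eq_integral_Ioo, ← intervalIntegral.integral_of_le zero_le_one, integral_id]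
        simp [hθ.le]
        ring

open scoped Pointwise in
/-- Gauss's lattice point count for a planar set that is star-shaped about the origin. -/
theorem tendsto_ncard_int_div_sq {S : Set (ℝ × ℝ)} (hb : Bornology.IsBounded S)
    (hm : MeasurableSet S) (hc : Convex ℝ S)
    (hstar : ∀ ⦃t : ℝ⦄, 0 < t → t ≤ 1 → ∀ p ∈ S, t • p ∈ S) :
    Tendsto (fun x : ℝ =>
        ({p : ℤ × ℤ | x⁻¹ • ((p.1 : ℝ), (p.2 : ℝ)) ∈ S}.ncard : ℝ) / x ^ 2)
      atTop (nhds (volume.real S)) := by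
  let e : (Fin 2 → ℝ) ≃L[ℝ] ℝ × ℝ := ContinuousLinearEquiv.finTwoArrow ℝ ℝ
  have he : MeasurePreserving e := volume_preserving_finTwoArrow ℝ
  have hconv : Convex ℝ (e ⁻¹' S) := hc.linear_preimage e.toLinearMap
  have hbdd : Bornology.IsBounded (e ⁻¹' S) := by
    rw [← e.image_symm_eq_preimage]
    exact e.symm.lipschitz.isBounded_image hb
  have h := tendsto_card_div_pow_atTop_volume' (e ⁻¹' S) hbdd (he.measurable hm)
    (hconv.addHaar_frontier volume) ?_
  · rw [measureReal_def, he.measure_preimage hm.nullMeasurableSet, Fintype.card_fin] at h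
    refine h.congr' ?_
    filter_upwards [eventually_gt_atTop 0] with x hx
    congr 2
    let f : ℤ × ℤ → (Fin 2 → ℝ) := fun p => x⁻¹ • ![(p.1 : ℝ), (p.2 : ℝ)]
    have hf : Function.Injective f := by
      rintro ⟨a, b⟩ ⟨c, d⟩ h
      have := smul_right_injective _ (inv_ne_zero hx.ne') h
      simpa using this
    rw [Nat.card_coe_set_eq, ← Set.ncard_image_of_injective _ hf]
    congr 1
    ext v
    simp only [mem_inter_iff, mem_preimage, mem_image, mem_smul_set, SetLike.mem_coe,
      (Pi.basisFun ℝ (Fin 2)).mem_span_iff_repr_mem ℤ]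
    constructor
    · rintro ⟨hv, w, hw, rfl⟩
      obtain ⟨a, ha⟩ := hw 0
      obtain ⟨b, hb⟩ := hw 1
      have hw' : w = ![(a : ℝ), (b : ℝ)] := by
        ext i
        fin_cases i
        · simpa using ha.symm
        · simpa using hb.symm
      subst hw'
      exact ⟨(a, b), hv, rfl⟩
    · rintro ⟨⟨a, b⟩, hp, rfl⟩
      refine ⟨hp, _, fun i => ?_, rfl⟩
      fin_cases i
      · exact ⟨a, by simp⟩
      · exact ⟨b, by simp⟩
  · rintro x y hx hxy _ ⟨v, hv, rfl⟩
    have hy := hx.trans_le hxy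
    refine ⟨(x / y) • v, ?_, ?_⟩
    · rw [mem_preimage, map_smul]
      exact hstar (div_pos hx hy) ((div_le_one hy).mpr hxy) _ hv
    · simp only [smul_smul, mul_div_cancel₀ _ hy.ne']

/-- The points of `ℕ × ℕ` in the sector of radius `x` and angle `θ`. -/
def latticeSector (θ x : ℝ) : Set (ℕ × ℕ) :=
  {p | 0 < p.1 ∧ 0 < p.2 ∧ (p.1 : ℝ) ^ 2 + (p.2 : ℝ) ^ 2 < x ^ 2 ∧
    (p.2 : ℝ) ≤ (p.1 : ℝ) * tan θ}

theorem inv_smul_mem_unitSector_iff {θ x a b : ℝ} (hx : 0 < x) :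
    x⁻¹ • (a, b) ∈ unitSector θ ↔
      0 < a ∧ 0 < b ∧ a ^ 2 + b ^ 2 < x ^ 2 ∧ b ≤ a * tan θ := by
  have h : (x⁻¹ * a) ^ 2 + (x⁻¹ * b) ^ 2 = (a ^ 2 + b ^ 2) / x ^ 2 := by
    field_simp
  simp only [unitSector, Prod.smul_mk, smul_eq_mul, mem_ofPred_eq, h, inv_pos.mpr hx,
    mul_pos_iff_of_pos_left, mul_assoc, mul_le_mul_iff_right₀, div_lt_one (pow_pos hx 2)]

theorem mul_mem_latticeSector_iff {θ x : ℝ} {d : ℕ} (hd : 0 < d) (p : ℕ × ℕ) :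
    (d * p.1, d * p.2) ∈ latticeSector θ x ↔ p ∈ latticeSector θ (x / d) := by
  have hd' : (0 : ℝ) < d := by exact_mod_cast hd
  simp only [latticeSector, mem_ofPred_eq, Nat.cast_mul, mul_pow, ← mul_add, div_pow,
    lt_div_iff₀' (pow_pos hd' 2), mul_assoc, mul_le_mul_iff_right₀ hd', mul_pos_iff_of_pos_left hd]

theorem latticeSector_subset {θ x : ℝ} (hx : 0 ≤ x) :
    latticeSector θ x ⊆ (Finset.Icc 1 ⌊x⌋₊ ×ˢ Finset.Icc 1 ⌊x⌋₊ : Finset (ℕ × ℕ)) := by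
  rintro ⟨a, b⟩ ⟨h1, h2, h3, -⟩
  simp only at h1 h2 h3
  simp only [Finset.coe_product, Finset.coe_Icc, mem_prod, mem_Icc, Nat.le_floor_iff hx]
  exact ⟨⟨h1, (pow_le_pow_iff_left₀ (by positivity) hx two_ne_zero).mp (by nlinarith)⟩,
    ⟨h2, (pow_le_pow_iff_left₀ (by positivity) hx two_ne_zero).mp (by nlinarith)⟩⟩

theorem finite_latticeSector (θ : ℝ) {x : ℝ} (hx : 0 ≤ x) : (latticeSector θ x).Finite :=
  (Finset.finite_toSet _).subset (latticeSector_subset hx)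

theorem ncard_latticeSector_le (θ : ℝ) {x : ℝ} (hx : 0 ≤ x) :
    ((latticeSector θ x).ncard : ℝ) ≤ x ^ 2 := by
  have h := Set.ncard_le_ncard (latticeSector_subset (θ := θ) hx) (Finset.finite_toSet _)
  rw [Set.ncard_coe_finset, Finset.card_product, Nat.card_Icc, Nat.add_sub_cancel] at h
  calc ((latticeSector θ x).ncard : ℝ) ≤ ((⌊x⌋₊ * ⌊x⌋₊ : ℕ) : ℝ) := by exact_mod_cast h
    _ = (⌊x⌋₊ : ℝ) ^ 2 := by push_cast; ring
    _ ≤ x ^ 2 := by gcongr; exact Nat.floor_le hx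

theorem isBounded_unitSector (θ : ℝ) : Bornology.IsBounded (unitSector θ) :=
  (Metric.isBounded_Icc _ _).subset (unitSector_subset θ)

theorem natCast_int_prodMap_injective :
    Function.Injective (Prod.map (Nat.cast : ℕ → ℤ) (Nat.cast : ℕ → ℤ)) :=
  Nat.cast_injective.prodMap Nat.cast_injective

theorem tendsto_ncard_latticeSector {θ : ℝ} (hθ : 0 < θ) (hθ' : θ < π / 2) :
    Tendsto (fun x : ℝ => ((latticeSector θ x).ncard : ℝ) / x ^ 2) atTop (nhds (θ / 2)) := by
  rw [← volume_real_unitSector hθ hθ']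
  refine (tendsto_ncard_int_div_sq (isBounded_unitSector θ) (measurableSet_unitSector θ)
    (convex_unitSector θ) fun t ht ht' p hp => smul_mem_unitSector ht ht' hp).congr' ?_
  filter_upwards [eventually_gt_atTop 0] with x hx
  rw [← Set.ncard_image_of_injective (latticeSector θ x) natCast_int_prodMap_injective]
  congr 3
  ext ⟨a, b⟩
  rw [mem_ofPred_eq, inv_smul_mem_unitSector_iff hx]
  constructor
  · rintro ⟨h1, h2, h3, h4⟩
    lift a to ℕ using by exact_mod_cast h1.le
    lift b to ℕ using by exact_mod_cast h2.le
    simp only [Nat.cast_pos, Int.cast_natCast] at h1 h2 h3 h4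
    exact ⟨(a, b), ⟨by exact_mod_cast h1, by exact_mod_cast h2, by exact_mod_cast h3,
      by exact_mod_cast h4⟩, rfl⟩
  · rintro ⟨⟨c, d⟩, ⟨h1, h2, h3, h4⟩, h⟩
    obtain ⟨rfl, rfl⟩ := Prod.mk.inj h
    simp only at h1 h2 h3 h4
    simp only [Int.cast_natCast]
    exact ⟨by exact_mod_cast h1, by exact_mod_cast h2, by exact_mod_cast h3,
      by exact_mod_cast h4⟩

/-- The linear map whose integral points are sent to the lattice of `(a, b)` with `a ≡ b` mod 2. -/
def parityMap : ℝ × ℝ →ₗ[ℝ] ℝ × ℝ :=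
  (LinearMap.snd ℝ ℝ ℝ + (2 : ℝ) • LinearMap.fst ℝ ℝ ℝ).prod (LinearMap.snd ℝ ℝ ℝ)

theorem parityMap_apply (p : ℝ × ℝ) : parityMap p = (p.2 + 2 * p.1, p.2) := rfl

theorem det_parityMap : LinearMap.det parityMap = 2 := by
  rw [← LinearMap.det_toMatrix (Module.Basis.finTwoProd ℝ), Matrix.det_fin_two]
  simp [LinearMap.toMatrix_apply, parityMap_apply]

theorem tendsto_ncard_latticeSector_same_parity {θ : ℝ} (hθ : 0 < θ) (hθ' : θ < π / 2) :
    Tendsto (fun x : ℝ =>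
        ({p ∈ latticeSector θ x | p.1 % 2 = p.2 % 2}.ncard : ℝ) / x ^ 2)
      atTop (nhds (θ / 4)) := by
  have hdet : LinearMap.det parityMap ≠ 0 := by rw [det_parityMap]; norm_num
  have hvol : volume.real (parityMap ⁻¹' unitSector θ) = θ / 4 := by
    rw [measureReal_def, Measure.addHaar_preimage_linearMap _ hdet, ENNReal.toReal_mul,
      ← measureReal_def, volume_real_unitSector hθ hθ', det_parityMap, abs_of_pos (by norm_num),
      ENNReal.toReal_ofReal (by norm_num)]
    ring
  have hbdd : Bornology.IsBounded (parityMap ⁻¹' unitSector θ) := by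
    refine (Metric.isBounded_Icc ((-1, -1) : ℝ × ℝ) (1, 1)).subset fun p hp => ?_
    obtain ⟨⟨h1, h2⟩, h3, h4⟩ := unitSector_subset θ hp
    simp only [parityMap_apply, Prod.fst_zero, Prod.snd_zero, Prod.fst_one, Prod.snd_one] at *
    exact ⟨⟨by simp only; linarith, by simp only; linarith⟩,
      ⟨by simp only; linarith, by simp only; linarith⟩⟩
  rw [← hvol]
  refine (tendsto_ncard_int_div_sq hbdd
    (parityMap.continuous_of_finiteDimensional.measurable (measurableSet_unitSector θ))
    ((convex_unitSector θ).linear_preimage parityMap) fun t ht ht' p hp => ?_).congr' ?_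
  · rw [mem_preimage, map_smul]
    exact smul_mem_unitSector ht ht' hp
  filter_upwards [eventually_gt_atTop 0] with x hx
  have hinj : Function.Injective (fun p : ℤ × ℤ => (p.2 + 2 * p.1, p.2)) := by
    rintro ⟨a, b⟩ ⟨c, d⟩ h
    simp only [Prod.mk.injEq] at h ⊢
    omega
  rw [← Set.ncard_image_of_injective _ natCast_int_prodMap_injective,
    ← Set.ncard_image_of_injective _ hinj]
  congr 3
  ext ⟨a, b⟩
  constructor
  · rintro ⟨⟨c, d⟩, hp, h⟩
    obtain ⟨rfl, rfl⟩ := Prod.mk.inj h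
    rw [mem_ofPred_eq, mem_preimage, map_smul, parityMap_apply,
      inv_smul_mem_unitSector_iff hx] at hp
    obtain ⟨h1, h2, h3, h4⟩ := hp
    simp only at h1 h2 h3 h4
    obtain ⟨a, ha⟩ := Int.eq_ofNat_of_zero_le (a := d + 2 * c) (by exact_mod_cast h1.le)
    obtain ⟨b, rfl⟩ := Int.eq_ofNat_of_zero_le (a := d) (by exact_mod_cast h2.le)
    have ha' : ((b : ℤ) : ℝ) + 2 * (c : ℝ) = (a : ℝ) := by exact_mod_cast ha
    simp only [ha'] at h1 h2 h3 h4
    simp only [Int.cast_natCast] at h1 h2 h3 h4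
    exact ⟨(a, b), ⟨⟨by exact_mod_cast h1, by exact_mod_cast h2, h3, h4⟩, by simp only; omega⟩,
      Prod.ext ha.symm rfl⟩
  · rintro ⟨⟨c, d⟩, ⟨⟨h1, h2, h3, h4⟩, h5⟩, h⟩
    obtain ⟨rfl, rfl⟩ := Prod.mk.inj h
    simp only at h1 h2 h3 h4 h5
    obtain ⟨k, hk⟩ : ∃ k : ℤ, (c : ℤ) = d + 2 * k := ⟨((c : ℤ) - d) / 2, by omega⟩
    have hk' : ((d : ℤ) : ℝ) + 2 * (k : ℝ) = (c : ℝ) := by exact_mod_cast hk.symm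
    refine ⟨(k, d), ?_, Prod.ext hk.symm rfl⟩
    rw [mem_ofPred_eq, mem_preimage, map_smul, parityMap_apply, inv_smul_mem_unitSector_iff hx]
    simp only [hk']
    simp only [Int.cast_natCast]
    exact ⟨by exact_mod_cast h1, by exact_mod_cast h2, h3, h4⟩

/-- The points of opposite parity in the sector of radius `x` and angle `θ`. -/
def oppositeParitySector (θ x : ℝ) : Set (ℕ × ℕ) :=
  {p ∈ latticeSector θ x | p.1 % 2 ≠ p.2 % 2}

theorem tendsto_ncard_oppositeParitySector {θ : ℝ} (hθ : 0 < θ) (hθ' : θ < π / 2) :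
    Tendsto (fun x : ℝ => ((oppositeParitySector θ x).ncard : ℝ) / x ^ 2)
      atTop (nhds (θ / 4)) := by
  have h := (tendsto_ncard_latticeSector hθ hθ').sub
    (tendsto_ncard_latticeSector_same_parity hθ hθ')
  rw [show θ / 2 - θ / 4 = θ / 4 by ring] at h
  refine h.congr' ?_
  filter_upwards [eventually_gt_atTop 0] with x hx
  rw [← sub_div]
  congr 1
  have := Set.ncard_inter_add_ncard_sdiff_eq_ncard (latticeSector θ x) {p | p.1 % 2 = p.2 % 2}
    (finite_latticeSector θ hx.le)
  rw [sub_eq_iff_eq_add', ← this]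
  push_cast
  rfl

theorem finite_oppositeParitySector (θ : ℝ) {x : ℝ} (hx : 0 ≤ x) :
    (oppositeParitySector θ x).Finite :=
  (finite_latticeSector θ hx).subset (sep_subset _ _)

theorem ncard_oppositeParitySector_le (θ : ℝ) {x : ℝ} (hx : 0 ≤ x) :
    ((oppositeParitySector θ x).ncard : ℝ) ≤ x ^ 2 :=
  (Nat.cast_le.mpr (Set.ncard_le_ncard (sep_subset _ _) (finite_latticeSector θ hx))).trans
    (ncard_latticeSector_le θ hx)

theorem ncard_dvd_oppositeParitySector {θ x : ℝ} {d : ℕ} (hd : 0 < d) :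
    {p ∈ oppositeParitySector θ x | d ∣ p.1.gcd p.2}.ncard =
      if Odd d then (oppositeParitySector θ (x / d)).ncard else 0 := by
  split_ifs with h
  · have hinj : Function.Injective (fun p : ℕ × ℕ => (d * p.1, d * p.2)) := by
      rintro ⟨a, b⟩ ⟨c, e⟩ h
      simpa [hd.ne'] using h
    have hpar (a b : ℕ) : (d * a) % 2 ≠ (d * b) % 2 ↔ a % 2 ≠ b % 2 := by
      rw [Nat.mul_mod d a, Nat.mul_mod d b, Nat.odd_iff.mp h]
      simp
    have himage : {p ∈ oppositeParitySector θ x | d ∣ p.1.gcd p.2} =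
        (fun p : ℕ × ℕ => (d * p.1, d * p.2)) '' oppositeParitySector θ (x / d) := by
      ext ⟨a, b⟩
      constructor
      · rintro ⟨⟨hp, hpar'⟩, hdvd⟩
        obtain ⟨⟨a, rfl⟩, b, rfl⟩ := Nat.dvd_gcd_iff.mp hdvd
        exact ⟨(a, b), ⟨(mul_mem_latticeSector_iff hd (a, b)).mp hp, (hpar a b).mp hpar'⟩, rfl⟩
      · rintro ⟨⟨a, b⟩, ⟨hp, hpar'⟩, h⟩
        obtain ⟨rfl, rfl⟩ := Prod.mk.inj h
        exact ⟨⟨(mul_mem_latticeSector_iff hd (a, b)).mpr hp, (hpar a b).mpr hpar'⟩,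
          Nat.dvd_gcd ⟨a, rfl⟩ ⟨b, rfl⟩⟩
    rw [himage, Set.ncard_image_of_injective _ hinj]
  · convert! Set.ncard_empty (ℕ × ℕ)
    refine eq_empty_of_forall_notMem ?_
    rintro ⟨a, b⟩ ⟨⟨-, hpar⟩, hdvd⟩
    obtain ⟨ha, hb⟩ := Nat.dvd_gcd_iff.mp ((Nat.not_odd_iff_even.mp h).two_dvd.trans hdvd)
    exact hpar ((Nat.mod_eq_zero_of_dvd ha).trans (Nat.mod_eq_zero_of_dvd hb).symm)

theorem hasSum_moebius_dvd {n : ℕ} (hn : n ≠ 0) :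
    HasSum (fun d : ℕ => if d ∣ n then (moebius d : ℝ) else 0) (if n = 1 then 1 else 0) := by
  have h : ∑ d ∈ n.divisors, moebius d = if n = 1 then 1 else 0 := by
    rw [← coe_mul_zeta_apply, moebius_mul_coe_zeta, one_apply]
  have h' : ∑ d ∈ n.divisors, (if d ∣ n then (moebius d : ℝ) else 0) = if n = 1 then 1 else 0 := by
    rw [Finset.sum_congr rfl fun d hd => if_pos (Nat.dvd_of_mem_divisors hd)]
    exact_mod_cast h
  rw [← h']
  refine hasSum_sum_of_ne_finset_zero fun d hd => if_neg fun hdvd => hd ?_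
  exact Nat.mem_divisors.mpr ⟨hdvd, hn⟩

theorem hasSum_ncard_coprime (θ : ℝ) {x : ℝ} (hx : 0 ≤ x) :
    HasSum (fun d : ℕ =>
        if Odd d then (moebius d : ℝ) * (oppositeParitySector θ (x / d)).ncard else 0)
      ({p ∈ oppositeParitySector θ x | p.1.Coprime p.2}.ncard : ℝ) := by
  classical
  set T := (finite_oppositeParitySector θ hx).toFinset with hT
  have hcard (P : ℕ × ℕ → Prop) [DecidablePred P] :
      ({p ∈ oppositeParitySector θ x | P p}.ncard : ℝ) = ∑ p ∈ T, if P p then (1 : ℝ) else 0 := by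
    rw [Finset.sum_boole, ← Set.ncard_coe_finset]
    congr 2
    ext p
    simp [hT]
  rw [hcard]
  refine (hasSum_sum fun p hp => hasSum_moebius_dvd (n := p.1.gcd p.2) ?_).congr_fun fun d => ?_
  · rw [hT, Set.Finite.mem_toFinset] at hp
    exact (Nat.gcd_pos_of_pos_left _ hp.1.1).ne'
  · rcases Nat.eq_zero_or_pos d with rfl | hd
    · simp
    · have h := ncard_dvd_oppositeParitySector (θ := θ) (x := x) hd
      have h' := hcard fun p => d ∣ p.1.gcd p.2
      rw [h] at h'
      calc _ = (moebius d : ℝ) *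
            ((if Odd d then (oppositeParitySector θ (x / d)).ncard else 0 : ℕ) : ℝ) := by
              split_ifs <;> simp
        _ = _ := by simp only [h', Finset.mul_sum, mul_ite, mul_one, mul_zero]

theorem tendsto_ncard_coprime {θ : ℝ} (hθ : 0 < θ) (hθ' : θ < π / 2) :
    Tendsto (fun x : ℝ =>
        ({p ∈ oppositeParitySector θ x | p.1.Coprime p.2}.ncard : ℝ) / x ^ 2)
      atTop (nhds (2 * θ / π ^ 2)) := by
  have hlim : ∑' d : ℕ, (if Odd d then (moebius d : ℝ) / d ^ 2 else 0) * (θ / 4) =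
      2 * θ / π ^ 2 := by
    rw [(hasSum_odd_moebius_div_sq.mul_right (θ / 4)).tsum_eq]
    ring
  rw [← hlim]
  have hμ (d : ℕ) : |(moebius d : ℝ)| ≤ 1 := by exact_mod_cast abs_moebius_le_one (n := d)
  have hmain : Tendsto (fun x : ℝ => ∑' d : ℕ,
      (if Odd d then (moebius d : ℝ) * (oppositeParitySector θ (x / d)).ncard else 0) / x ^ 2)
      atTop (nhds (∑' d : ℕ, (if Odd d then (moebius d : ℝ) / d ^ 2 else 0) * (θ / 4))) := by
    refine tendsto_tsum_of_dominated_convergence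
      (bound := fun d : ℕ => 1 / (d : ℝ) ^ 2) hasSum_zeta_two.summable (fun d => ?_) ?_
    · split_ifs with hd
      · have hd0 : (0 : ℝ) < d := by exact_mod_cast hd.pos
        have h := ((tendsto_ncard_oppositeParitySector hθ hθ').comp
          (tendsto_id.atTop_div_const hd0)).const_mul ((moebius d : ℝ) / d ^ 2)
        refine h.congr fun x => ?_
        simp only [Function.comp, id]
        field_simp
      · simp
    · filter_upwards [eventually_gt_atTop 0] with x hx d
      split_ifs with hd
      · have hd0 : (0 : ℝ) < d := by exact_mod_cast hd.pos
        have h := ncard_oppositeParitySector_le θ (x := x / d) (by positivity)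
        rw [norm_div, norm_mul, Real.norm_eq_abs, Real.norm_natCast, Real.norm_eq_abs,
          abs_of_pos (by positivity : 0 < x ^ 2), div_le_iff₀ (by positivity)]
        calc _ ≤ 1 * (x / d) ^ 2 := by gcongr; exact hμ d
          _ = _ := by ring
      · simp
  refine hmain.congr' ?_
  filter_upwards [eventually_gt_atTop 0] with x hx
  rw [tsum_div_const, (hasSum_ncard_coprime θ hx.le).tsum_eq]

/-- Fix `0 < θ ≤ π/4` and let `f_θ(x)` be the number of pairs `(a, b)` of coprime positive
integers of opposite parity with `a² + b² < x²` and `b ≤ a·tan θ`. Then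
`f_θ(x) ∼ 2θ·x²/π²` as `x → ∞`. -/
theorem statement13 (θ : ℝ) (hθ : 0 < θ) (hθ' : θ ≤ π / 4) :
    Tendsto (fun x : ℝ =>
        (({p : ℕ × ℕ | 0 < p.1 ∧ 0 < p.2 ∧ Nat.Coprime p.1 p.2 ∧ p.1 % 2 ≠ p.2 % 2 ∧
            (p.1 : ℝ) ^ 2 + (p.2 : ℝ) ^ 2 < x ^ 2 ∧
            (p.2 : ℝ) ≤ (p.1 : ℝ) * Real.tan θ}.ncard : ℝ)) / (2 * θ * x ^ 2 / π ^ 2))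
      atTop (nhds 1) := by
  have hθ'' : θ < π / 2 := by linarith [pi_pos]
  have hc : (2 * θ / π ^ 2) ≠ 0 := by positivity
  have h := (tendsto_ncard_coprime hθ hθ'').div_const (2 * θ / π ^ 2)
  rw [div_self hc] at h
  refine h.congr fun x => ?_
  rw [div_div, show x ^ 2 * (2 * θ / π ^ 2) = 2 * θ * x ^ 2 / π ^ 2 by ring]
  congr 3
  ext p
  simp only [oppositeParitySector, latticeSector, mem_ofPred_eq]
  tauto
end

section
/- Let B_n be the set of triples (k, r, s) of positive integers with k odd, r > s, gcd(r, s) = 1, r and s of opposite parity, and k·(r² + s²) ≤ n. Then |B_n| ∼ (1/(4π))·n·log n as n → ∞, i.e. |B_n| / (n·log n / (4π)) → 1. -/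
open Filter Real

/-- Pairs of positive integers in the disc of radius `√n`. -/
def quadrantPairs (n : ℕ) : Finset (ℕ × ℕ) :=
  {p ∈ Finset.Icc 1 n.sqrt ×ˢ Finset.Icc 1 n.sqrt | p.1 ^ 2 + p.2 ^ 2 ≤ n}

theorem mem_quadrantPairs {n : ℕ} {p : ℕ × ℕ} :
    p ∈ quadrantPairs n ↔ 0 < p.1 ∧ 0 < p.2 ∧ p.1 ^ 2 + p.2 ^ 2 ≤ n := by
  simp only [quadrantPairs, Finset.mem_filter, Finset.mem_product, Finset.mem_Icc]
  constructor
  · rintro ⟨⟨⟨h1, -⟩, h2, -⟩, h⟩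
    exact ⟨h1, h2, h⟩
  · rintro ⟨h1, h2, h⟩
    refine ⟨⟨⟨h1, Nat.le_sqrt'.2 (by omega)⟩, h2, Nat.le_sqrt'.2 (by omega)⟩, h⟩

theorem card_quadrantPairs_le (n : ℕ) : (quadrantPairs n).card ≤ n := by
  refine (Finset.card_filter_le _ _).trans ?_
  simpa using Nat.sqrt_le n

theorem card_quadrantPairs (n : ℕ) :
    (quadrantPairs n).card = ∑ i ∈ Finset.range n.sqrt, (n - (i + 1) ^ 2).sqrt := by
  rw [quadrantPairs, Finset.card_filter, Finset.sum_product, ← Finset.Ico_succ_right_eq_Icc,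
    Finset.sum_Ico_eq_sum_range]
  refine Finset.sum_congr (by simp) fun i hi => ?_
  rw [← Finset.card_filter]
  have hi' : i + 1 ≤ n.sqrt := by simpa using hi
  have hle : (i + 1) ^ 2 ≤ n := Nat.le_sqrt'.1 hi'
  trans (Finset.Icc 1 (n - (i + 1) ^ 2).sqrt).card
  · congr 1
    ext s
    simp only [Finset.mem_filter, Finset.mem_Ico, Finset.mem_Icc, Nat.le_sqrt', Order.succ_eq_add_one,
      add_comm 1 i]
    have := Nat.le_sqrt' (m := s) (n := n)
    omega
  · simp

theorem integral_sqrt_sub_sq {n : ℝ} (hn : 0 < n) {R : ℝ} (hR : √n ≤ R) :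
    ∫ x in (0 : ℝ)..R, √(n - x ^ 2) = n * (π / 4) := by
  have hs : 0 < √n := Real.sqrt_pos.2 hn
  have hunit : ∫ x in (0 : ℝ)..1, √(1 - x ^ 2) = π / 4 := by
    have h := integral_sqrt_one_sub_sq
    have hneg : ∫ x in (-1 : ℝ)..0, √(1 - x ^ 2) = ∫ x in (0 : ℝ)..1, √(1 - x ^ 2) := by
      have := intervalIntegral.integral_comp_neg (a := 0) (b := 1) fun x : ℝ => √(1 - x ^ 2)
      simpa using this.symm
    rw [← intervalIntegral.integral_add_adjacent_intervals (b := 0)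
      (Continuous.intervalIntegrable (by fun_prop) _ _)
      (Continuous.intervalIntegrable (by fun_prop) _ _), hneg] at h
    linarith
  have htail : ∫ x in √n..R, √(n - x ^ 2) = 0 := by
    refine (intervalIntegral.integral_congr (g := fun _ => 0) fun x hx => ?_).trans (by simp)
    rw [Set.uIcc_of_le hR] at hx
    have : n ≤ x ^ 2 := (Real.sqrt_le_left (hs.le.trans hx.1)).1 hx.1
    exact Real.sqrt_eq_zero_of_nonpos (by linarith)
  rw [← intervalIntegral.integral_add_adjacent_intervals (b := √n)
      (Continuous.intervalIntegrable (by fun_prop) _ _)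
      (Continuous.intervalIntegrable (by fun_prop) _ _), htail, add_zero]
  have h := intervalIntegral.mul_integral_comp_mul_left (a := 0) (b := 1)
    (f := fun x : ℝ => √(n - x ^ 2)) √n
  rw [mul_zero, mul_one] at h
  rw [← h, ← hunit]
  have : ∀ x : ℝ, √(n - (√n * x) ^ 2) = √n * √(1 - x ^ 2) := fun x => by
    rw [← Real.sqrt_mul hn.le, mul_pow, Real.sq_sqrt hn.le]
    congr 1; ring
  simp_rw [this]
  rw [intervalIntegral.integral_const_mul, ← mul_assoc, Real.mul_self_sqrt hn.le]

theorem natSqrt_sub_sq_le (n i : ℕ) : ((n - i ^ 2).sqrt : ℝ) ≤ √((n : ℝ) - (i : ℝ) ^ 2) := by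
  rcases le_total (i ^ 2) n with h | h
  · have := Real.nat_sqrt_le_real_sqrt (a := n - i ^ 2)
    rwa [Nat.cast_sub h, Nat.cast_pow] at this
  · simp [Nat.sub_eq_zero_of_le h]

theorem sqrt_sub_sq_le_natSqrt_add_one (n i : ℕ) :
    √((n : ℝ) - (i : ℝ) ^ 2) ≤ ((n - i ^ 2).sqrt : ℝ) + 1 := by
  rcases le_total (i ^ 2) n with h | h
  · have := Real.real_sqrt_le_nat_sqrt_succ (a := n - i ^ 2)
    rwa [Nat.cast_sub h, Nat.cast_pow] at this
  · rw [Real.sqrt_eq_zero_of_nonpos]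
    · positivity
    · have : (n : ℝ) ≤ (i : ℝ) ^ 2 := by exact_mod_cast h
      linarith

theorem abs_card_quadrantPairs_sub_le {n : ℕ} (hn : 0 < n) :
    |((quadrantPairs n).card : ℝ) - n * (π / 4)| ≤ 2 * √n := by
  set m := n.sqrt with hm
  set f : ℝ → ℝ := fun x => √((n : ℝ) - x ^ 2) with hf
  have hanti : AntitoneOn f (Set.Icc 0 (0 + ((m + 1 : ℕ) : ℝ))) := fun x hx y _ hxy =>
    Real.sqrt_le_sqrt (by have := pow_le_pow_left₀ hx.1 hxy 2; linarith)
  have hR : √(n : ℝ) ≤ ((m + 1 : ℕ) : ℝ) := by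
    exact_mod_cast Real.real_sqrt_le_nat_sqrt_succ (a := n)
  have hI := integral_sqrt_sub_sq (by exact_mod_cast hn : (0 : ℝ) < n) hR
  have hle := hanti.sum_le_integral
  have hge := hanti.integral_le_sum
  simp only [zero_add] at hle hge
  rw [hI] at hle hge
  rw [Finset.sum_range_succ] at hle
  rw [Finset.sum_range_succ'] at hge
  have hnn : 0 ≤ f ((m + 1 : ℕ) : ℝ) := Real.sqrt_nonneg _
  have hf0 : f ((0 : ℕ) : ℝ) = √n := by simp [hf]
  have hms : (m : ℝ) ≤ √n := Real.nat_sqrt_le_real_sqrt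
  have h1 : ((quadrantPairs n).card : ℝ) ≤ ∑ i ∈ Finset.range m, f ((i + 1 : ℕ) : ℝ) := by
    rw [card_quadrantPairs, Nat.cast_sum]
    exact Finset.sum_le_sum fun i _ => natSqrt_sub_sq_le n (i + 1)
  have h2 : ∑ i ∈ Finset.range m, f ((i + 1 : ℕ) : ℝ) ≤ (quadrantPairs n).card + m := by
    calc _ ≤ ∑ i ∈ Finset.range m, (((n - (i + 1) ^ 2).sqrt : ℝ) + 1) :=
          Finset.sum_le_sum fun i _ => sqrt_sub_sq_le_natSqrt_add_one n (i + 1)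
      _ = _ := by rw [card_quadrantPairs, Finset.sum_add_distrib]; simp [hm]
  rw [hf0] at hge
  rw [abs_le]
  constructor <;> linarith [Real.sqrt_nonneg (n : ℝ)]

/-- Pairs `r > s > 0` in the disc of radius `√n`. -/
def sectorPairs (n : ℕ) : Finset (ℕ × ℕ) := {p ∈ quadrantPairs n | p.2 < p.1}

theorem mem_sectorPairs {n : ℕ} {p : ℕ × ℕ} :
    p ∈ sectorPairs n ↔ 0 < p.2 ∧ p.2 < p.1 ∧ p.1 ^ 2 + p.2 ^ 2 ≤ n := by
  simp only [sectorPairs, Finset.mem_filter, mem_quadrantPairs]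
  constructor
  · rintro ⟨⟨-, h1, h⟩, h2⟩
    exact ⟨h1, h2, h⟩
  · rintro ⟨h1, h2, h⟩
    exact ⟨⟨by omega, h1, h⟩, h2⟩

theorem card_quadrantPairs_eq_two_mul_add (n : ℕ) : (quadrantPairs n).card =
    2 * (sectorPairs n).card + {p ∈ quadrantPairs n | p.2 = p.1}.card := by
  have hswap : {p ∈ quadrantPairs n | p.1 < p.2}.card = (sectorPairs n).card := by
    refine Finset.card_bij' (fun p _ => p.swap) (fun p _ => p.swap) ?_ ?_ ?_ ?_ <;>
      simp only [sectorPairs, Finset.mem_filter, mem_quadrantPairs, Prod.fst_swap, Prod.snd_swap,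
        Prod.swap_swap, implies_true]
    all_goals
      rintro p ⟨⟨h1, h2, h⟩, h3⟩
      exact ⟨⟨h2, h1, by omega⟩, h3⟩
  have h1 := Finset.card_filter_add_card_filter_not (s := quadrantPairs n) (fun p => p.2 < p.1)
  have h2 := Finset.card_filter_add_card_filter_not
    (s := {p ∈ quadrantPairs n | ¬ p.2 < p.1}) (fun p => p.2 = p.1)
  have h3 : {p ∈ {p ∈ quadrantPairs n | ¬ p.2 < p.1} | p.2 = p.1} =
      {p ∈ quadrantPairs n | p.2 = p.1} := by
    rw [Finset.filter_filter]
    exact Finset.filter_congr fun p _ => by omega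
  have h4 : {p ∈ {p ∈ quadrantPairs n | ¬ p.2 < p.1} | ¬ p.2 = p.1} =
      {p ∈ quadrantPairs n | p.1 < p.2} := by
    rw [Finset.filter_filter]
    exact Finset.filter_congr fun p _ => by omega
  rw [h3, h4, hswap] at h2
  rw [sectorPairs] at *
  omega

theorem card_quadrantPairs_diagonal_le (n : ℕ) :
    {p ∈ quadrantPairs n | p.2 = p.1}.card ≤ n.sqrt := by
  rw [← Nat.card_Icc 1 n.sqrt |>.trans (Nat.add_sub_cancel _ _)]
  refine Finset.card_le_card_of_injOn Prod.fst ?_ ?_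
  · intro p hp
    simp only [Finset.coe_filter, Set.mem_ofPred_eq, mem_quadrantPairs] at hp
    simp only [Finset.coe_Icc, Set.mem_Icc]
    exact ⟨hp.1.1, Nat.le_sqrt'.2 (by omega)⟩
  · rintro ⟨a, b⟩ hp ⟨c, d⟩ hq h
    simp only [Finset.coe_filter, Set.mem_ofPred_eq] at hp hq h
    simp [h, hp.2, hq.2]

theorem tendsto_card_sectorPairs_div :
    Tendsto (fun n : ℕ => ((sectorPairs n).card : ℝ) / n) atTop (nhds (π / 8)) := by
  have hlim : Tendsto (fun n : ℕ => 3 / 2 * (1 / √(n : ℝ))) atTop (nhds 0) := by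
    simpa using ((tendsto_inv_atTop_zero.comp
      (Real.tendsto_sqrt_atTop.comp tendsto_natCast_atTop_atTop)).const_mul (3 / 2 : ℝ))
  rw [tendsto_iff_norm_sub_tendsto_zero]
  refine squeeze_zero' (Eventually.of_forall fun _ => norm_nonneg _) ?_ hlim
  filter_upwards [eventually_gt_atTop 0] with n hn
  have hn' : (0 : ℝ) < n := by exact_mod_cast hn
  have h1 := abs_le.1 (abs_card_quadrantPairs_sub_le hn)
  have h2 : ((quadrantPairs n).card : ℝ) = 2 * (sectorPairs n).card +
    ({p ∈ quadrantPairs n | p.2 = p.1}.card : ℝ) := by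
    exact_mod_cast card_quadrantPairs_eq_two_mul_add n
  have h3 : ({p ∈ quadrantPairs n | p.2 = p.1}.card : ℝ) ≤ √n :=
    (Nat.cast_le.2 (card_quadrantPairs_diagonal_le n)).trans Real.nat_sqrt_le_real_sqrt
  have h4 : (0 : ℝ) ≤ ({p ∈ quadrantPairs n | p.2 = p.1}.card : ℝ) := by positivity
  have hs : √(n : ℝ) / n = 1 / √n := Real.sqrt_div_self'
  have key : |((sectorPairs n).card : ℝ) - n * (π / 8)| ≤ 3 / 2 * √n := by
    rw [abs_le]
    constructor <;> linarith
  calc ‖((sectorPairs n).card : ℝ) / n - π / 8‖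
      = |((sectorPairs n).card : ℝ) - n * (π / 8)| / n := by
        rw [Real.norm_eq_abs, ← abs_of_pos hn', ← abs_div, abs_of_pos hn']
        congr 1; field_simp
    _ ≤ 3 / 2 * √n / n := by gcongr
    _ = _ := by rw [mul_div_assoc, hs]

theorem tendsto_natCast_div_div (m : ℕ) :
    Tendsto (fun n : ℕ => ((n / m : ℕ) : ℝ) / n) atTop (nhds (1 / m)) := by
  refine ((tendsto_nat_floor_mul_div_atTop (R := ℝ) (a := 1 / m) (by positivity)).comp
    tendsto_natCast_atTop_atTop).congr fun n => ?_
  rw [Function.comp_apply, one_div_mul_eq_div, Nat.floor_div_eq_div]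

theorem tendsto_comp_natDiv_div {a : ℕ → ℝ} {c : ℝ}
    (ha : Tendsto (fun n : ℕ => a n / n) atTop (nhds c)) {m : ℕ} (hm : 0 < m) :
    Tendsto (fun n : ℕ => a (n / m) / n) atTop (nhds (c / m)) := by
  have h := (ha.comp (Nat.tendsto_div_const_atTop hm.ne')).mul (tendsto_natCast_div_div m)
  rw [mul_one_div] at h
  refine h.congr' ?_
  filter_upwards [eventually_ge_atTop m] with n hn
  have : ((n / m : ℕ) : ℝ) ≠ 0 := by exact_mod_cast (Nat.div_pos hn hm).ne'
  simp only [Function.comp_apply]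
  field_simp

/-- Pairs `r > s > 0` of opposite parity in the disc of radius `√n`. -/
def oppositeParityPairs (n : ℕ) : Finset (ℕ × ℕ) := {p ∈ sectorPairs n | p.1 % 2 ≠ p.2 % 2}

theorem mem_oppositeParityPairs {n : ℕ} {p : ℕ × ℕ} :
    p ∈ oppositeParityPairs n ↔
      0 < p.2 ∧ p.2 < p.1 ∧ p.1 ^ 2 + p.2 ^ 2 ≤ n ∧ p.1 % 2 ≠ p.2 % 2 := by
  simp only [oppositeParityPairs, Finset.mem_filter, mem_sectorPairs, and_assoc]

theorem card_oppositeParityPairs_le (n : ℕ) : (oppositeParityPairs n).card ≤ n :=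
  ((Finset.card_filter_le _ _).trans (Finset.card_filter_le _ _)).trans (card_quadrantPairs_le n)

theorem card_sectorPairs_eq_add (n : ℕ) :
    (sectorPairs n).card = (oppositeParityPairs n).card + (sectorPairs (n / 2)).card := by
  rw [← Finset.card_filter_add_card_filter_not (s := sectorPairs n) (fun p => p.1 % 2 ≠ p.2 % 2),
    oppositeParityPairs, Nat.add_left_cancel_iff]
  refine Finset.card_bij' (fun p _ => ((p.1 + p.2) / 2, (p.1 - p.2) / 2))
    (fun p _ => (p.1 + p.2, p.1 - p.2)) ?_ ?_ ?_ ?_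
  · rintro ⟨r, s⟩ h
    simp only [Finset.mem_filter, mem_sectorPairs, not_not] at h ⊢
    obtain ⟨⟨h1, h2, h3⟩, h4⟩ := h
    refine ⟨by omega, by omega, ?_⟩
    obtain ⟨v, rfl⟩ : ∃ v, r = s + 2 * v := ⟨(r - s) / 2, by omega⟩
    rw [show (s + 2 * v + s) / 2 = s + v by omega, show (s + 2 * v - s) / 2 = v by omega,
      Nat.le_div_iff_mul_le two_pos]
    nlinarith
  · rintro ⟨u, v⟩ h
    simp only [Finset.mem_filter, mem_sectorPairs, not_not] at h ⊢
    obtain ⟨h1, h2, h3⟩ := h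
    obtain ⟨w, rfl⟩ := Nat.exists_eq_add_of_lt h2
    rw [Nat.le_div_iff_mul_le two_pos] at h3
    refine ⟨⟨by omega, by omega, ?_⟩, by omega⟩
    rw [show v + w + 1 - v = w + 1 by omega]
    nlinarith
  · rintro ⟨r, s⟩ h
    simp only [Finset.mem_filter, mem_sectorPairs, not_not] at h
    ext <;> simp only <;> omega
  · rintro ⟨u, v⟩ h
    simp only [mem_sectorPairs] at h
    ext <;> simp only <;> omega

theorem tendsto_card_oppositeParityPairs_div :
    Tendsto (fun n : ℕ => ((oppositeParityPairs n).card : ℝ) / n) atTop (nhds (π / 16)) := by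
  have h := tendsto_card_sectorPairs_div.sub
    (tendsto_comp_natDiv_div tendsto_card_sectorPairs_div two_pos)
  rw [show π / 8 - π / 8 / (2 : ℕ) = π / 16 by push_cast; ring] at h
  refine h.congr fun n => ?_
  rw [card_sectorPairs_eq_add n]
  push_cast
  ring

theorem card_oppositeParityPairs_dvd {n d : ℕ} (hd : Odd d) :
    {p ∈ oppositeParityPairs n | d ∣ p.1 ∧ d ∣ p.2}.card =
      (oppositeParityPairs (n / d ^ 2)).card := by
  have hd0 : 0 < d := hd.pos
  have hpar (a b : ℕ) : d * a % 2 ≠ d * b % 2 ↔ a % 2 ≠ b % 2 := by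
    simp [Nat.mul_mod, Nat.odd_iff.1 hd]
  have hmem (a b : ℕ) : (d * a, d * b) ∈ oppositeParityPairs n ↔
      (a, b) ∈ oppositeParityPairs (n / d ^ 2) := by
    simp only [mem_oppositeParityPairs, hpar, Nat.le_div_iff_mul_le (pow_pos hd0 2),
      Nat.mul_lt_mul_left hd0, Nat.mul_pos_iff_of_pos_left hd0]
    rw [show (d * a) ^ 2 + (d * b) ^ 2 = (a ^ 2 + b ^ 2) * d ^ 2 by ring]
  symm
  refine Finset.card_bij (fun p _ => (d * p.1, d * p.2)) ?_ ?_ ?_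
  · rintro ⟨a, b⟩ h
    exact Finset.mem_filter.2 ⟨(hmem a b).2 h, dvd_mul_right _ _, dvd_mul_right _ _⟩
  · rintro ⟨a, b⟩ _ ⟨a', b'⟩ _ h
    simpa [hd0.ne'] using h
  · rintro ⟨x, y⟩ h
    obtain ⟨h, ⟨a, rfl⟩, b, rfl⟩ := Finset.mem_filter.1 h
    exact ⟨(a, b), (hmem a b).1 h, rfl⟩

/-- Coprime pairs `r > s > 0` of opposite parity in the disc of radius `√n`. -/
def primitivePairs (n : ℕ) : Finset (ℕ × ℕ) := {p ∈ oppositeParityPairs n | p.1.Coprime p.2}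

open ArithmeticFunction in
theorem card_primitivePairs (n : ℕ) :
    ((primitivePairs n).card : ℤ) = ∑ d ∈ Finset.range (n + 1),
      if Odd d then moebius d * (oppositeParityPairs (n / d ^ 2)).card else 0 := by
  have hpt : ∀ p ∈ oppositeParityPairs n, (if p.1.Coprime p.2 then (1 : ℤ) else 0) =
      ∑ d ∈ Finset.range (n + 1), if d ∣ p.1 ∧ d ∣ p.2 then moebius d else 0 := fun p hp => by
    obtain ⟨h1, h2, h3, -⟩ := mem_oppositeParityPairs.1 hp
    have hdiv : (p.1.gcd p.2).divisors =
        {d ∈ Finset.range (n + 1) | d ∣ p.1 ∧ d ∣ p.2} := by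
      ext d
      simp only [Nat.mem_divisors, Finset.mem_filter, Finset.mem_range, Nat.dvd_gcd_iff]
      refine ⟨fun h => ⟨?_, h.1⟩, fun h => ⟨h.2, (Nat.gcd_pos_of_pos_right _ h1).ne'⟩⟩
      have := Nat.le_of_dvd h1 h.1.2
      nlinarith
    rw [← Finset.sum_filter, ← hdiv, ← coe_mul_zeta_apply, moebius_mul_coe_zeta, one_apply]
  rw [primitivePairs, Finset.card_filter, Nat.cast_sum]
  simp only [Nat.cast_ite, Nat.cast_one, Nat.cast_zero]
  rw [Finset.sum_congr rfl hpt, Finset.sum_comm]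
  refine Finset.sum_congr rfl fun d _ => ?_
  rw [← Finset.sum_filter, Finset.sum_const, nsmul_eq_mul, mul_comm]
  split_ifs with hd
  · rw [card_oppositeParityPairs_dvd hd]
  · rw [Finset.filter_eq_empty_iff.2, Finset.card_empty, Nat.cast_zero, mul_zero]
    rintro p hp ⟨h1, h2⟩
    have h2d : 2 ∣ d := even_iff_two_dvd.1 (Nat.not_odd_iff_even.1 hd)
    have := (mem_oppositeParityPairs.1 hp).2.2.2
    have := h2d.trans h1
    have := h2d.trans h2
    omega

open ArithmeticFunction in
theorem tsum_odd_moebius_div_sq :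
    ∑' d : ℕ, (if Odd d then (moebius d : ℝ) / (d : ℝ) ^ 2 else 0) = 8 / π ^ 2 := by
  have hs : (1 : ℝ) < (2 : ℂ).re := by norm_num
  have h := DirichletCharacter.LSeries.mul_mu_eq_one (1 : DirichletCharacter ℂ 2) hs
  have hL := DirichletCharacter.LFunctionTrivChar_eq_mul_riemannZeta (N := 2) (s := 2) (by norm_num)
  rw [DirichletCharacter.LFunctionTrivChar,
    DirichletCharacter.LFunction_eq_LSeries _ hs, riemannZeta_two, Nat.prime_two.primeFactors,
    Finset.prod_singleton] at hL
  rw [hL] at h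
  have hterm : LSeries ((fun n : ℕ => (1 : DirichletCharacter ℂ 2) n) *
      fun n : ℕ => ((moebius n : ℤ) : ℂ)) 2 =
      ((∑' d : ℕ, (if Odd d then (moebius d : ℝ) / (d : ℝ) ^ 2 else 0) : ℝ) : ℂ) := by
    rw [LSeries, Complex.ofReal_tsum]
    refine tsum_congr fun d => ?_
    rw [LSeries.term_def₀ (by simp)]
    by_cases hd : Odd d
    · have hu : IsUnit ((d : ℕ) : ZMod 2) := by
        rw [ZMod.isUnit_iff_coprime]; exact hd.coprime_two_right
      simp [hd, MulChar.one_apply hu, Complex.cpow_neg, div_eq_mul_inv]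
    · have hu : ¬ IsUnit ((d : ℕ) : ZMod 2) := by
        rwa [ZMod.isUnit_iff_coprime, Nat.coprime_two_right]
      simp [hd, MulChar.map_nonunit _ hu]
  rw [hterm] at h
  have h2 : (3 / 4 * (π ^ 2 / 6)) *
      ∑' d : ℕ, (if Odd d then (moebius d : ℝ) / (d : ℝ) ^ 2 else 0) = 1 := by
    apply Complex.ofReal_injective
    rw [Complex.ofReal_mul, Complex.ofReal_one, ← h]
    congr 1
    rw [Complex.cpow_neg]
    push_cast
    norm_num
  have := Real.pi_ne_zero
  field_simp at h2 ⊢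
  linarith

open ArithmeticFunction in
theorem tendsto_card_primitivePairs_div :
    Tendsto (fun n : ℕ => ((primitivePairs n).card : ℝ) / n) atTop (nhds (1 / (2 * π))) := by
  have hsum (n : ℕ) : ((primitivePairs n).card : ℝ) / n = ∑' d : ℕ,
      if Odd d then (moebius d : ℝ) * (((oppositeParityPairs (n / d ^ 2)).card : ℝ) / n) else 0 := by
    rw [tsum_eq_sum (s := Finset.range (n + 1))]
    · have := congrArg (Int.cast : ℤ → ℝ) (card_primitivePairs n)
      push_cast at this
      rw [this, Finset.sum_div]
      refine Finset.sum_congr rfl fun d _ => ?_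
      split_ifs
      · ring
      · simp
    · intro d hd
      have hd' : n < d := by simpa using hd
      have : (oppositeParityPairs (n / d ^ 2)).card = 0 := by
        rw [Nat.div_eq_of_lt (by nlinarith)]
        exact Nat.le_zero.1 (card_oppositeParityPairs_le 0)
      simp [this]
  have hval : ∑' d : ℕ, (if Odd d then (moebius d : ℝ) * (π / 16 / ((d ^ 2 : ℕ) : ℝ)) else 0) =
      1 / (2 * π) := by
    trans π / 16 * (8 / π ^ 2)
    · rw [← tsum_odd_moebius_div_sq, ← tsum_mul_left]
      refine tsum_congr fun d => ?_
      split_ifs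
      · push_cast; ring
      · simp
    · have := Real.pi_ne_zero
      field_simp
      norm_num
  rw [← hval, funext hsum]
  refine tendsto_tsum_of_dominated_convergence
    (Real.summable_one_div_nat_pow.2 one_lt_two) (fun d => ?_) ?_
  · split_ifs with hd
    · exact (tendsto_comp_natDiv_div tendsto_card_oppositeParityPairs_div
        (pow_pos hd.pos 2)).const_mul _
    · exact tendsto_const_nhds
  · filter_upwards [eventually_gt_atTop 0] with n hn d
    have hn' : (0 : ℝ) < n := by exact_mod_cast hn
    split_ifs with hd
    · have hmu : |(moebius d : ℝ)| ≤ 1 := by exact_mod_cast abs_moebius_le_one (n := d)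
      have hc : ((oppositeParityPairs (n / d ^ 2)).card : ℝ) ≤ n / (d : ℝ) ^ 2 := by
        refine (Nat.cast_le.2 (card_oppositeParityPairs_le _)).trans ?_
        exact_mod_cast Nat.cast_div_le (α := ℝ) (m := n) (n := d ^ 2)
      rw [norm_mul, Real.norm_eq_abs, Real.norm_of_nonneg (by positivity)]
      calc _ ≤ 1 * ((n / (d : ℝ) ^ 2) / n) := by gcongr
        _ = _ := by field_simp
    · simp

theorem sum_odd_inv_eq (n : ℕ) : ∑ k ∈ Finset.Icc 1 n with Odd k, (k : ℝ)⁻¹ =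
    harmonic n - (harmonic (n / 2) : ℝ) / 2 := by
  have h := Finset.sum_filter_add_sum_filter_not (Finset.Icc 1 n) Odd (fun k : ℕ => (k : ℝ)⁻¹)
  have heven : ∑ k ∈ Finset.Icc 1 n with ¬ Odd k, (k : ℝ)⁻¹ =
      ∑ j ∈ Finset.Icc 1 (n / 2), (j : ℝ)⁻¹ / 2 := by
    symm
    refine Finset.sum_bij (fun j _ => 2 * j) ?_ ?_ ?_ ?_
    · intro j hj
      simp only [Finset.mem_Icc, Finset.mem_filter] at hj ⊢
      exact ⟨by omega, by simp⟩
    · intro a _ b _ h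
      omega
    · intro k hk
      simp only [Finset.mem_Icc, Finset.mem_filter, Nat.not_odd_iff] at hk
      exact ⟨k / 2, by simp only [Finset.mem_Icc]; omega, by omega⟩
    · intro j _
      push_cast
      rw [mul_inv]; ring
  rw [heven, ← Finset.sum_div] at h
  rw [harmonic_eq_sum_Icc, harmonic_eq_sum_Icc]
  push_cast
  linarith

theorem abs_sum_odd_inv_sub_le {n : ℕ} (hn : 0 < n) :
    |∑ k ∈ Finset.Icc 1 n with Odd k, (k : ℝ)⁻¹ - Real.log n / 2| ≤ 2 := by
  have hn' : (0 : ℝ) < n := by exact_mod_cast hn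
  rw [sum_odd_inv_eq]
  have h1 : Real.log n ≤ harmonic n :=
    (Real.log_le_log hn' (by simp)).trans (log_add_one_le_harmonic n)
  have h2 := harmonic_le_one_add_log n
  have h3 : Real.log n - 1 ≤ harmonic (n / 2) := by
    refine le_trans ?_ (log_add_one_le_harmonic (n / 2))
    have : (n : ℝ) / 2 ≤ ((n / 2 + 1 : ℕ) : ℝ) := by
      rw [div_le_iff₀ two_pos]
      exact_mod_cast (by omega : n ≤ (n / 2 + 1) * 2)
    have h := Real.log_le_log (by positivity) this
    rw [Real.log_div hn'.ne' two_ne_zero] at h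
    linarith [Real.log_two_lt_d9]
  have h4 : (harmonic (n / 2) : ℝ) ≤ 1 + Real.log n := by
    refine le_trans ?_ h2
    rw [harmonic_eq_sum_Icc, harmonic_eq_sum_Icc]
    exact_mod_cast Finset.sum_le_sum_of_subset_of_nonneg
      (Finset.Icc_subset_Icc_right (Nat.div_le_self n 2)) fun i _ _ => by positivity
  rw [abs_le]
  constructor <;> linarith

theorem exists_abs_sub_le_of_tendsto_div {a : ℕ → ℝ} {c : ℝ}
    (ha : Tendsto (fun n : ℕ => a n / n) atTop (nhds c)) {ε : ℝ} (hε : 0 < ε) :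
    ∃ C : ℝ, 0 ≤ C ∧ ∀ m : ℕ, |a m - c * m| ≤ ε * m + C := by
  obtain ⟨N, hN⟩ := Metric.tendsto_atTop.1 ha ε hε
  refine ⟨∑ m ∈ Finset.range (N + 1), |a m - c * m|,
    Finset.sum_nonneg fun _ _ => abs_nonneg _, fun m => ?_⟩
  rcases lt_or_ge m (N + 1) with hm | hm
  · have := Finset.single_le_sum (f := fun m : ℕ => |a m - c * m|) (fun _ _ => abs_nonneg _)
      (Finset.mem_range.2 hm)
    have : 0 ≤ ε * m := by positivity
    linarith
  · have hm' : (0 : ℝ) < m := by exact_mod_cast (by omega : 0 < m)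
    have h := hN m (by omega)
    rw [Real.dist_eq, div_sub' hm'.ne', abs_div, abs_of_pos hm', div_lt_iff₀ hm', mul_comm (m : ℝ)]
      at h
    have : 0 ≤ ∑ m ∈ Finset.range (N + 1), |a m - c * m| :=
      Finset.sum_nonneg fun _ _ => abs_nonneg _
    linarith

theorem abs_sum_odd_natDiv_sub_le {a : ℕ → ℝ} {c ε C : ℝ} (hε : 0 ≤ ε) (hC : 0 ≤ C)
    (ha : ∀ m : ℕ, |a m - c * m| ≤ ε * m + C) {n : ℕ} (hn : 0 < n) :
    |∑ k ∈ Finset.Icc 1 n with Odd k, a (n / k) - c / 2 * (n * Real.log n)| ≤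
      ε / 2 * (n * Real.log n) + (C + 3 * |c| + 2 * ε) * n := by
  set S := {k ∈ Finset.Icc 1 n | Odd k} with hS
  have hn' : (0 : ℝ) < n := by exact_mod_cast hn
  have hO := abs_sum_odd_inv_sub_le hn
  rw [← hS] at hO
  set O := ∑ k ∈ S, (k : ℝ)⁻¹ with hOdef
  have hcard : (S.card : ℝ) ≤ n := by
    exact_mod_cast (Finset.card_filter_le _ _).trans (by simp)
  have hk : ∀ k ∈ S, |a (n / k) - c * n * (k : ℝ)⁻¹| ≤ ε * n * (k : ℝ)⁻¹ + (C + |c|) := by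
    intro k hk
    have hk0 : 0 < k := (Finset.mem_Icc.1 (Finset.mem_filter.1 hk).1).1
    have hle : ((n / k : ℕ) : ℝ) ≤ n * (k : ℝ)⁻¹ := by
      rw [← div_eq_mul_inv]; exact Nat.cast_div_le
    have hge : (n : ℝ) * (k : ℝ)⁻¹ ≤ ((n / k : ℕ) : ℝ) + 1 := by
      rw [← div_eq_mul_inv, ← Nat.floor_div_eq_div (K := ℝ)]
      exact (Nat.lt_floor_add_one _).le
    have h1 : |c * ((n / k : ℕ) : ℝ) - c * (n * (k : ℝ)⁻¹)| ≤ |c| := by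
      rw [← mul_sub, abs_mul]
      refine mul_le_of_le_one_right (abs_nonneg _) ?_
      rw [abs_le]
      constructor <;> linarith
    calc _ = |(a (n / k) - c * ((n / k : ℕ) : ℝ)) +
          (c * ((n / k : ℕ) : ℝ) - c * (n * (k : ℝ)⁻¹))| := by congr 1; ring
      _ ≤ (ε * ((n / k : ℕ) : ℝ) + C) + |c| := (abs_add_le _ _).trans (add_le_add (ha _) h1)
      _ ≤ (ε * (n * (k : ℝ)⁻¹) + C) + |c| := by gcongr
      _ = _ := by ring
  have hmain : |∑ k ∈ S, a (n / k) - c * n * O| ≤ ε * n * O + n * (C + |c|) := by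
    rw [hOdef, Finset.mul_sum, ← Finset.sum_sub_distrib]
    refine (Finset.abs_sum_le_sum_abs _ _).trans ((Finset.sum_le_sum hk).trans ?_)
    rw [Finset.sum_add_distrib, Finset.sum_const, nsmul_eq_mul, ← Finset.mul_sum]
    gcongr
  have hO2 : |c * n * O - c / 2 * (n * Real.log n)| ≤ |c| * n * 2 := by
    rw [show c * n * O - c / 2 * (n * Real.log n) = c * n * (O - Real.log n / 2) by ring, abs_mul,
      abs_mul, abs_of_pos hn']
    gcongr
  have hO3 : ε * n * O ≤ ε * n * (Real.log n / 2 + 2) := by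
    gcongr
    linarith [(abs_le.1 hO).2]
  have := abs_sub_le (∑ k ∈ S, a (n / k)) (c * n * O) (c / 2 * (n * Real.log n))
  linarith

theorem tendsto_sum_odd_natDiv {a : ℕ → ℝ} {c : ℝ}
    (ha : Tendsto (fun n : ℕ => a n / n) atTop (nhds c)) :
    Tendsto (fun n : ℕ => (∑ k ∈ Finset.Icc 1 n with Odd k, a (n / k)) / (n * Real.log n))
      atTop (nhds (c / 2)) := by
  rw [Metric.tendsto_nhds]
  intro ε hε
  obtain ⟨C, hC, hb⟩ := exists_abs_sub_le_of_tendsto_div ha hε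
  have hlog := (Real.tendsto_log_atTop.comp tendsto_natCast_atTop_atTop).eventually_gt_atTop
    (2 * (C + 3 * |c| + 2 * ε) / ε)
  filter_upwards [hlog, eventually_gt_atTop 0] with n hn hn0
  have hn' : (0 : ℝ) < n := by exact_mod_cast hn0
  rw [Function.comp_apply, div_lt_iff₀ hε] at hn
  have hl : 0 < Real.log n := by
    by_contra! h
    have := mul_nonpos_of_nonpos_of_nonneg h hε.le
    have : 0 ≤ 2 * (C + 3 * |c| + 2 * ε) := by positivity
    linarith
  have hpos : 0 < n * Real.log n := mul_pos hn' hl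
  have h := abs_sum_odd_natDiv_sub_le hε.le hC hb hn0
  rw [Real.dist_eq, div_sub' hpos.ne', abs_div, abs_of_pos hpos, div_lt_iff₀ hpos,
    mul_comm (n * Real.log n) (c / 2)]
  nlinarith

theorem ncard_triples (n : ℕ) :
    {t : ℕ × ℕ × ℕ | 0 < t.1 ∧ Odd t.1 ∧ t.2.2 < t.2.1 ∧ 0 < t.2.2 ∧
      Nat.Coprime t.2.1 t.2.2 ∧ t.2.1 % 2 ≠ t.2.2 % 2 ∧
      t.1 * (t.2.1 ^ 2 + t.2.2 ^ 2) ≤ n}.ncard =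
    ∑ k ∈ Finset.Icc 1 n with Odd k, (primitivePairs (n / k)).card := by
  rw [← Finset.card_sigma, ← Finset.card_map (Equiv.sigmaEquivProd ℕ (ℕ × ℕ)).toEmbedding,
    ← Set.ncard_coe_finset]
  congr 1
  ext ⟨k, r, s⟩
  simp only [Set.mem_ofPred_eq, Finset.mem_coe, Finset.mem_map_equiv,
    Equiv.sigmaEquivProd_symm_apply, Finset.mem_sigma, Finset.mem_filter, Finset.mem_Icc,
    primitivePairs, mem_oppositeParityPairs]
  constructor
  · rintro ⟨hk, hodd, hrs, hs, hco, hpar, hle⟩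
    refine ⟨⟨⟨hk, ?_⟩, hodd⟩, ⟨hs, hrs, ?_, hpar⟩, hco⟩
    · exact (Nat.le_mul_of_pos_right k (by positivity)).trans hle
    · rwa [Nat.le_div_iff_mul_le hk, mul_comm]
  · rintro ⟨⟨⟨hk, -⟩, hodd⟩, ⟨hs, hrs, hle, hpar⟩, hco⟩
    rw [Nat.le_div_iff_mul_le hk, mul_comm] at hle
    exact ⟨hk, hodd, hrs, hs, hco, hpar, hle⟩

/-- Let `B_n` be the set of triples `(k, r, s)` of positive integers with `k` odd,
`r > s`, `gcd(r, s) = 1`, `r` and `s` of opposite parity, and `k·(r² + s²) ≤ n`.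
Then `|B_n| ∼ n·log n/(4π)` as `n → ∞`. -/
theorem statement14 :
    Tendsto (fun n : ℕ =>
        (({t : ℕ × ℕ × ℕ | 0 < t.1 ∧ Odd t.1 ∧ t.2.2 < t.2.1 ∧ 0 < t.2.2 ∧
            Nat.Coprime t.2.1 t.2.2 ∧ t.2.1 % 2 ≠ t.2.2 % 2 ∧
            t.1 * (t.2.1 ^ 2 + t.2.2 ^ 2) ≤ n}.ncard : ℝ)) /
          ((n : ℝ) * Real.log n / (4 * π)))
      atTop (nhds 1) := by
  have h := (tendsto_sum_odd_natDiv tendsto_card_primitivePairs_div).mul_const (4 * π)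
  have hpi := Real.pi_ne_zero
  rw [show 1 / (2 * π) / 2 * (4 * π) = 1 by field_simp; norm_num] at h
  refine h.congr fun n => ?_
  rw [ncard_triples, Nat.cast_sum, div_div_eq_mul_div, div_mul_eq_mul_div]
end
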